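/- arXiv:1901.02782 — 6 statements merged into one kernel-verified Lean document; each statement's English description precedes it below -/
import Mathlib

section
/- Let Φ : (0,∞) → (0,∞) be continuous with ∫₀^∞ Φ(z) dz = 1, let T_c > 0, t₀ ∈ ℝ, and x₀ > 0. Suppose x : [t₀, t₁) → (0,∞) is differentiable with x(t₀) = x₀, x'(t) = −(1/T_c)·(1/Φ(x(t))) for all t ∈ [t₀,t₁), and lim_{t→t₁⁻} x(t) = 0. Then t₁ − t₀ = T_c ∫₀^{x₀} Φ(z) dz, and in particular t₁ − t₀ < T_c. -/
open Set MeasureTheory Filter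

/-- The primitive of a function continuous and integrable on `(0, ∞)` is differentiable there. -/
theorem hasDerivAt_primitive_of_integrableOn_Ioi {Φ : ℝ → ℝ} (hc : ContinuousOn Φ (Ioi 0))
    (hi : IntegrableOn Φ (Ioi 0)) {y : ℝ} (hy : 0 < y) :
    HasDerivAt (fun u => ∫ z in (0 : ℝ)..u, Φ z) (Φ y) y := by
  refine intervalIntegral.integral_hasDerivAt_right ?_
    (hc.stronglyMeasurableAtFilter isOpen_Ioi y hy) (hc.continuousAt (Ioi_mem_nhds hy))
  rw [intervalIntegrable_iff_integrableOn_Ioc_of_le hy.le]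
  exact hi.mono_set Ioc_subset_Ioi_self

/-- The primitive of a function integrable on `(0, ∞)` tends to zero at the origin. -/
theorem tendsto_primitive_zero_of_integrableOn_Ioi {Φ : ℝ → ℝ} (hi : IntegrableOn Φ (Ioi 0)) :
    Tendsto (fun u => ∫ z in (0 : ℝ)..u, Φ z) (nhdsWithin 0 (Ioi 0)) (nhds 0) := by
  have hcont : ContinuousOn (fun u => ∫ z in (0 : ℝ)..u, Φ z) (Icc 0 1) := by
    have h : IntegrableOn Φ (uIcc 0 1) := by
      rw [uIcc_of_le zero_le_one, integrableOn_Icc_iff_integrableOn_Ioc]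
      exact hi.mono_set Ioc_subset_Ioi_self
    simpa [uIcc_of_le zero_le_one] using intervalIntegral.continuousOn_primitive_interval h
  have h := (hcont 0 (by simp)).tendsto
  rw [intervalIntegral.integral_same] at h
  refine h.mono_left ?_
  rw [← nhdsWithin_Ioc_eq_nhdsGT (zero_lt_one' ℝ)]
  exact nhdsWithin_mono _ Ioc_subset_Icc_self

/-- An initial segment carries strictly less than the whole integral of a positive function. -/
theorem intervalIntegral_lt_integral_Ioi {Φ : ℝ → ℝ} (hpos : ∀ z > (0 : ℝ), 0 < Φ z)
    (hi : IntegrableOn Φ (Ioi 0)) {a : ℝ} (ha : 0 < a) :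
    ∫ z in (0 : ℝ)..a, Φ z < ∫ z in Ioi (0 : ℝ), Φ z := by
  have hia : IntegrableOn Φ (Ioi a) := hi.mono_set (Ioi_subset_Ioi ha.le)
  have hsplit := intervalIntegral.integral_interval_add_Ioi hi hia
  have htail : 0 < ∫ z in Ioi a, Φ z := by
    rw [setIntegral_pos_iff_support_of_nonneg_ae _ hia]
    · have hs : Function.support Φ ∩ Ioi a = Ioi a :=
        inter_eq_right.2 fun z hz => (hpos z (ha.trans hz)).ne'
      simp [hs]
    · filter_upwards [ae_restrict_mem measurableSet_Ioi] with z hz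
      exact (hpos z (ha.trans hz)).le
  linarith

theorem stmt4
    (Φ : ℝ → ℝ)
    (hΦc : ContinuousOn Φ (Set.Ioi 0))
    (hΦpos : ∀ z > (0:ℝ), 0 < Φ z)
    (hΦint : MeasureTheory.IntegrableOn Φ (Set.Ioi 0))
    (hΦ1 : ∫ z in Set.Ioi (0:ℝ), Φ z = 1)
    (Tc t₀ t₁ x₀ : ℝ) (hTc : 0 < Tc) (hx₀ : 0 < x₀) (ht : t₀ < t₁)
    (x : ℝ → ℝ) (hx0 : x t₀ = x₀)
    (hxpos : ∀ t ∈ Set.Ico t₀ t₁, 0 < x t)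
    (hxd : ∀ t ∈ Set.Ico t₀ t₁,
      HasDerivWithinAt x (-(1 / Tc) * (1 / Φ (x t))) (Set.Ico t₀ t₁) t)
    (hxlim : Filter.Tendsto x (nhdsWithin t₁ (Set.Iio t₁)) (nhds 0)) :
    t₁ - t₀ = Tc * ∫ z in (0:ℝ)..x₀, Φ z ∧ t₁ - t₀ < Tc := by
  have hderiv : ∀ t ∈ Ico t₀ t₁,
      HasDerivWithinAt (fun s => (∫ z in (0 : ℝ)..x s, Φ z) + s / Tc) 0 (Ico t₀ t₁) t := by
    intro t ht'
    have h := ((hasDerivAt_primitive_of_integrableOn_Ioi hΦc hΦint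
      (hxpos t ht')).comp_hasDerivWithinAt t (hxd t ht')).add
      ((hasDerivWithinAt_id t (Ico t₀ t₁)).div_const Tc)
    have hne := (hΦpos _ (hxpos t ht')).ne'
    refine h.congr_deriv ?_
    field_simp
    ring
  have hconst : ∀ s ∈ Ico t₀ t₁,
      (∫ z in (0 : ℝ)..x s, Φ z) + s / Tc = (∫ z in (0 : ℝ)..x₀, Φ z) + t₀ / Tc := by
    intro s hs
    rw [← hx0]
    refine constant_of_has_deriv_right_zero (a := t₀) (b := s)
      (f := fun s => (∫ z in (0 : ℝ)..x s, Φ z) + s / Tc)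
      (fun t ht' => ?_) (fun t ht' => ?_) s ⟨hs.1, le_rfl⟩
    · exact (hderiv t ⟨ht'.1, ht'.2.trans_lt hs.2⟩).continuousWithinAt.mono
        fun r hr => ⟨hr.1, hr.2.trans_lt hs.2⟩
    · have htt : t < t₁ := ht'.2.trans hs.2
      exact (hderiv t ⟨ht'.1, htt⟩).mono_of_mem_nhdsWithin
        (mem_of_superset (Ico_mem_nhdsGE htt) (Ico_subset_Ico_left ht'.1))
  have hnear : ∀ᶠ s in nhdsWithin t₁ (Iio t₁), s ∈ Ico t₀ t₁ := Ico_mem_nhdsLT ht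
  have hxlim' : Tendsto x (nhdsWithin t₁ (Iio t₁)) (nhdsWithin 0 (Ioi 0)) :=
    tendsto_nhdsWithin_iff.2 ⟨hxlim, hnear.mono hxpos⟩
  have hlim : Tendsto (fun s => (∫ z in (0 : ℝ)..x s, Φ z) + s / Tc)
      (nhdsWithin t₁ (Iio t₁)) (nhds (0 + t₁ / Tc)) :=
    ((tendsto_primitive_zero_of_integrableOn_Ioi hΦint).comp hxlim').add
      ((tendsto_id.mono_left nhdsWithin_le_nhds).div_const Tc)
  have heq : 0 + t₁ / Tc = (∫ z in (0 : ℝ)..x₀, Φ z) + t₀ / Tc :=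
    tendsto_nhds_unique hlim (tendsto_const_nhds.congr' (hnear.mono fun s hs => (hconst s hs).symm))
  have hsettle : t₁ - t₀ = Tc * ∫ z in (0 : ℝ)..x₀, Φ z := by
    field_simp at heq
    linarith
  have hlt := intervalIntegral_lt_integral_Ioi hΦpos hΦint hx₀
  rw [hΦ1] at hlt
  exact ⟨hsettle, hsettle ▸ mul_lt_of_lt_one_right hTc hlt⟩
end

section
/- Let H : ℝ → ℝ be continuous with H(0) = 0 and z·H(z) > 0 for all z ≠ 0. Let x̃ : [0,∞) → (0,∞) be differentiable with x̃'(τ) = −H(x̃(τ)) for all τ ≥ 0 and lim_{τ→∞} x̃(τ) = 0. Let Φ : (0,∞) → (0,∞) be continuous with ∫₀^∞ Φ(z) dz = 1, T_c > 0, t₀ ∈ ℝ, ψ(τ) = T_c∫₀^τ Φ(ξ)dξ, and let ψ⁻¹ : [0,T_c) → [0,∞) be the inverse of ψ. Then x : [t₀, t₀+T_c) → (0,∞) defined by x(t) = x̃(ψ⁻¹(t−t₀)) satisfies x(t₀) = x̃(0), is differentiable with x'(t) = −(1/T_c)·(1/Φ(ψ⁻¹(t−t₀)))·H(x(t)) on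 (t₀, t₀+T_c), x(t) > 0 for all t ∈ [t₀, t₀+T_c), and lim_{t→(t₀+T_c)⁻} x(t) = 0; that is, the trajectory converges to zero exactly at time t₀ + T_c. -/
open Set MeasureTheory Filter

section IntegralOfPositive

variable {Φ : ℝ → ℝ}

theorem intervalIntegrable_of_integrableOn_Ioi (hΦint : IntegrableOn Φ (Ioi 0)) {a b : ℝ}
    (ha : 0 ≤ a) (hb : 0 ≤ b) : IntervalIntegrable Φ volume a b := by
  rw [intervalIntegrable_iff]
  exact hΦint.mono_set fun z hz => lt_of_le_of_lt (le_min ha hb) hz.1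

theorem strictMonoOn_integral_of_pos (hΦpos : ∀ z > (0 : ℝ), 0 < Φ z)
    (hΦint : IntegrableOn Φ (Ioi 0)) :
    StrictMonoOn (fun τ => ∫ ξ in (0 : ℝ)..τ, Φ ξ) (Ici 0) := by
  intro a ha b hb hab
  have ha' : (0 : ℝ) ≤ a := ha
  have hpos : 0 < ∫ ξ in a..b, Φ ξ :=
    intervalIntegral.intervalIntegral_pos_of_pos_on
      (intervalIntegrable_of_integrableOn_Ioi hΦint ha hb)
      (fun z hz => hΦpos z (ha'.trans_lt hz.1)) hab
  have hadd := intervalIntegral.integral_add_adjacent_intervals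
    (intervalIntegrable_of_integrableOn_Ioi hΦint le_rfl ha)
    (intervalIntegrable_of_integrableOn_Ioi hΦint ha hb)
  simp only
  linarith

theorem integral_lt_setIntegral_Ioi_of_pos (hΦpos : ∀ z > (0 : ℝ), 0 < Φ z)
    (hΦint : IntegrableOn Φ (Ioi 0)) {τ : ℝ} (hτ : 0 ≤ τ) :
    ∫ ξ in (0 : ℝ)..τ, Φ ξ < ∫ z in Ioi (0 : ℝ), Φ z := by
  have hτ' : 0 ≤ τ + 1 := by linarith
  refine (strictMonoOn_integral_of_pos hΦpos hΦint hτ hτ' (lt_add_one τ)).trans_le ?_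
  simp only
  rw [intervalIntegral.integral_of_le hτ']
  refine setIntegral_mono_set hΦint ?_ Ioc_subset_Ioi_self.eventuallyLE
  filter_upwards [ae_restrict_mem measurableSet_Ioi] with z hz using (hΦpos z hz).le

theorem hasDerivAt_integral_of_continuousOn_Ioi (hΦc : ContinuousOn Φ (Ioi 0))
    (hΦint : IntegrableOn Φ (Ioi 0)) {τ : ℝ} (hτ : 0 < τ) :
    HasDerivAt (fun u => ∫ ξ in (0 : ℝ)..u, Φ ξ) (Φ τ) τ :=
  intervalIntegral.integral_hasDerivAt_right
    (intervalIntegrable_of_integrableOn_Ioi hΦint le_rfl hτ.le)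
    (hΦc.stronglyMeasurableAtFilter isOpen_Ioi τ hτ)
    (hΦc.continuousAt (Ioi_mem_nhds hτ))

end IntegralOfPositive

section InverseOfStrictMono

variable {f g : ℝ → ℝ} {T : ℝ}

theorem continuousAt_inverse_of_strictMonoOn_Ici (hf : StrictMonoOn f (Ici 0)) (hf0 : f 0 = 0)
    (hfT : ∀ τ, 0 ≤ τ → f τ < T) (hgf : ∀ τ, 0 ≤ τ → g (f τ) = τ)
    (hfg : ∀ s ∈ Ico 0 T, 0 ≤ g s ∧ f (g s) = s) {s : ℝ} (hs : s ∈ Ioo 0 T) :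
    ContinuousAt g s := by
  have hg : StrictMonoOn g (Ioo 0 T) := by
    intro a ha b hb hab
    obtain ⟨ha0, hga⟩ := hfg a (Ioo_subset_Ico_self ha)
    obtain ⟨hb0, hgb⟩ := hfg b (Ioo_subset_Ico_self hb)
    rwa [← hf.lt_iff_lt ha0 hb0, hga, hgb]
  refine hg.continuousAt_of_image_mem_nhds (Ioo_mem_nhds hs.1 hs.2) ?_
  obtain ⟨hs0, hgs⟩ := hfg s (Ioo_subset_Ico_self hs)
  have hgpos : 0 < g s := by
    rw [← hf.lt_iff_lt self_mem_Ici hs0, hgs, hf0]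
    exact hs.1
  filter_upwards [Ioi_mem_nhds hgpos] with τ hτ
  have hτ0 : (0 : ℝ) < τ := hτ
  refine ⟨f τ, ⟨?_, hfT τ hτ0.le⟩, hgf τ hτ0.le⟩
  simpa [hf0] using hf self_mem_Ici hτ0.le hτ0

theorem tendsto_atTop_inverse_of_strictMonoOn_Ici (hf : StrictMonoOn f (Ici 0)) (hf0 : f 0 = 0)
    (hfT : ∀ τ, 0 ≤ τ → f τ < T)
    (hfg : ∀ s ∈ Ico 0 T, 0 ≤ g s ∧ f (g s) = s) :
    Tendsto g (nhdsWithin T (Iio T)) atTop := by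
  refine tendsto_atTop.2 fun M => ?_
  have hM : (0 : ℝ) ≤ max M 0 := le_max_right _ _
  filter_upwards [Ioo_mem_nhdsLT (hfT _ hM)] with s hs
  have hfM : 0 ≤ f (max M 0) := by
    simpa [hf0] using hf.monotoneOn self_mem_Ici hM hM
  obtain ⟨hs0, hgs⟩ := hfg s ⟨hfM.trans hs.1.le, hs.2⟩
  refine (le_max_left M 0).trans ?_
  rw [← hf.le_iff_le hM hs0, hgs]
  exact hs.1.le

end InverseOfStrictMono

theorem stmt7
    (H : ℝ → ℝ) (hHc : Continuous H) (hH0 : H 0 = 0)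
    (hHpos : ∀ z : ℝ, z ≠ 0 → 0 < z * H z)
    (xt : ℝ → ℝ)
    (hxtpos : ∀ τ : ℝ, 0 ≤ τ → 0 < xt τ)
    (hxtd : ∀ τ : ℝ, 0 ≤ τ → HasDerivWithinAt xt (-(H (xt τ))) (Set.Ici 0) τ)
    (hxtlim : Filter.Tendsto xt Filter.atTop (nhds 0))
    (Φ : ℝ → ℝ)
    (hΦc : ContinuousOn Φ (Set.Ioi 0))
    (hΦpos : ∀ z > (0:ℝ), 0 < Φ z)
    (hΦint : MeasureTheory.IntegrableOn Φ (Set.Ioi 0))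
    (hΦ1 : ∫ z in Set.Ioi (0:ℝ), Φ z = 1)
    (Tc t₀ : ℝ) (hTc : 0 < Tc)
    (ψ : ℝ → ℝ) (hψ : ∀ τ, ψ τ = Tc * ∫ ξ in (0:ℝ)..τ, Φ ξ)
    (ψinv : ℝ → ℝ)
    (hψinv₁ : ∀ τ : ℝ, 0 ≤ τ → ψinv (ψ τ) = τ)
    (hψinv₂ : ∀ s ∈ Set.Ico (0:ℝ) Tc, 0 ≤ ψinv s ∧ ψ (ψinv s) = s)
    (x : ℝ → ℝ) (hx : ∀ t, x t = xt (ψinv (t - t₀))) :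
    x t₀ = xt 0 ∧
    (∀ t ∈ Set.Ioo t₀ (t₀ + Tc),
      HasDerivAt x (-(1 / Tc) * (1 / Φ (ψinv (t - t₀))) * H (x t)) t) ∧
    (∀ t ∈ Set.Ico t₀ (t₀ + Tc), 0 < x t) ∧
    Filter.Tendsto x (nhdsWithin (t₀ + Tc) (Set.Iio (t₀ + Tc))) (nhds 0) := by
  have hψ_eq : ψ = fun τ => Tc * ∫ ξ in (0 : ℝ)..τ, Φ ξ := funext hψ
  have hψ0 : ψ 0 = 0 := by simp [hψ]
  have hψmono : StrictMonoOn ψ (Ici 0) := by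
    rw [hψ_eq]
    exact fun a ha b hb hab =>
      mul_lt_mul_of_pos_left (strictMonoOn_integral_of_pos hΦpos hΦint ha hb hab) hTc
  have hψlt : ∀ τ, 0 ≤ τ → ψ τ < Tc := by
    intro τ hτ
    have h := integral_lt_setIntegral_Ioi_of_pos hΦpos hΦint hτ
    rw [hΦ1] at h
    rw [hψ]
    exact mul_lt_of_lt_one_right hTc h
  refine ⟨?_, ?_, ?_, ?_⟩
  · have h := hψinv₁ 0 le_rfl
    rw [hψ0] at h
    rw [hx, sub_self, h]
  · intro t ht
    have hs : t - t₀ ∈ Ioo 0 Tc := ⟨by linarith [ht.1], by linarith [ht.2]⟩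
    obtain ⟨hτ0, hτs⟩ := hψinv₂ _ (Ioo_subset_Ico_self hs)
    have hτpos : 0 < ψinv (t - t₀) := by
      rw [← hψmono.lt_iff_lt self_mem_Ici hτ0, hτs, hψ0]
      exact hs.1
    have hψd : HasDerivAt ψ (Tc * Φ (ψinv (t - t₀))) (ψinv (t - t₀)) := by
      rw [hψ_eq]
      exact (hasDerivAt_integral_of_continuousOn_Ioi hΦc hΦint hτpos).const_mul Tc
    have hinv : HasDerivAt ψinv (Tc * Φ (ψinv (t - t₀)))⁻¹ (t - t₀) := by
      refine hψd.of_local_left_inverse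
        (continuousAt_inverse_of_strictMonoOn_Ici hψmono hψ0 hψlt hψinv₁ hψinv₂ hs)
        (mul_pos hTc (hΦpos _ hτpos)).ne' ?_
      filter_upwards [Ioo_mem_nhds hs.1 hs.2] with s hs'
      exact (hψinv₂ s (Ioo_subset_Ico_self hs')).2
    have hxd := (hxtd _ hτ0).hasDerivAt (Ici_mem_nhds hτpos)
    have hcomp := hxd.comp t (hinv.comp_sub_const t t₀)
    rw [← show x = xt ∘ fun u => ψinv (u - t₀) from funext hx] at hcomp
    refine hcomp.congr_deriv ?_
    rw [hx t, mul_inv]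
    ring
  · intro t ht
    rw [hx]
    exact hxtpos _ (hψinv₂ _ ⟨by linarith [ht.1], by linarith [ht.2]⟩).1
  · have hshift : Tendsto (fun t => t - t₀) (nhdsWithin (t₀ + Tc) (Iio (t₀ + Tc)))
        (nhdsWithin Tc (Iio Tc)) := by
      refine tendsto_nhdsWithin_iff.2 ⟨?_, ?_⟩
      · have h : Tendsto (fun t => t - t₀) (nhds (t₀ + Tc)) (nhds (t₀ + Tc - t₀)) :=
          (continuous_id.sub continuous_const).tendsto _
        rw [add_sub_cancel_left] at h
        exact h.mono_left nhdsWithin_le_nhds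
      · filter_upwards [self_mem_nhdsWithin] with t ht
        exact sub_lt_iff_lt_add'.2 (mem_Iio.1 ht)
    rw [show x = fun t => xt (ψinv (t - t₀)) from funext hx]
    exact hxtlim.comp
      ((tendsto_atTop_inverse_of_strictMonoOn_Ici hψmono hψ0 hψlt hψinv₂).comp hshift)
end

section
/- Let Φ : (0,∞) → (0,∞) be continuous with ∫₀^∞ Φ(z) dz = 1, let T_c > 0 and t₀ ∈ ℝ. Let v : [t₀,∞) → [0,∞) be continuous, differentiable at every t with v(t) > 0, and satisfy v'(t) ≤ −(1/T_c)·(1/Φ(v(t))) at every t with v(t) > 0. Then v(t) = 0 for all t ≥ t₀ + T_c∫₀^{v(t₀)}Φ(z)dz; in particular v(t) = 0 for all t ≥ t₀ + T_c. -/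
open Set MeasureTheory Filter

/-- The primitive from `0` of a function integrable on `(0, ∞)` is continuous on `[0, ∞)`. -/
theorem continuousOn_primitive_Ici {Φ : ℝ → ℝ} (hΦint : IntegrableOn Φ (Ioi 0)) :
    ContinuousOn (fun y => ∫ z in (0:ℝ)..y, Φ z) (Ici 0) := by
  have hint : Integrable ((Ioi 0).indicator Φ) :=
    (integrable_indicator_iff measurableSet_Ioi).2 hΦint
  have hcont : Continuous fun y => ∫ z in (0:ℝ)..y, (Ioi 0).indicator Φ z :=
    intervalIntegral.continuous_primitive (fun a b => hint.intervalIntegrable) 0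
  refine hcont.continuousOn.congr fun y hy => ?_
  have hy : (0:ℝ) ≤ y := hy
  simp only [intervalIntegral.integral_of_le hy]
  exact setIntegral_congr_fun measurableSet_Ioc fun z hz =>
    (indicator_of_mem (s := Ioi 0) hz.1 Φ).symm

theorem intervalIntegrable_zero_of_integrableOn_Ioi {Φ : ℝ → ℝ}
    (hΦint : IntegrableOn Φ (Ioi 0)) {y : ℝ} (hy : 0 ≤ y) :
    IntervalIntegrable Φ volume 0 y :=
  (intervalIntegrable_iff_integrableOn_Ioc_of_le hy).2 (hΦint.mono_set Ioc_subset_Ioi_self)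

theorem hasDerivAt_primitive_of_pos {Φ : ℝ → ℝ} (hΦc : ContinuousOn Φ (Ioi 0))
    (hΦint : IntegrableOn Φ (Ioi 0)) {y : ℝ} (hy : 0 < y) :
    HasDerivAt (fun y => ∫ z in (0:ℝ)..y, Φ z) (Φ y) y :=
  intervalIntegral.integral_hasDerivAt_right
    (intervalIntegrable_zero_of_integrableOn_Ioi hΦint hy.le)
    (hΦc.stronglyMeasurableAtFilter isOpen_Ioi y hy)
    (hΦc.continuousAt (Ioi_mem_nhds hy))

/-- Along a solution of the differential inequality that stays positive on `(s, t)`, the primitive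
of `Φ` decreases at rate at least `1 / Tc`. -/
theorem primitive_comp_add_div_le {Φ : ℝ → ℝ} (hΦc : ContinuousOn Φ (Ioi 0))
    (hΦpos : ∀ z > (0:ℝ), 0 < Φ z) (hΦint : IntegrableOn Φ (Ioi 0))
    {Tc t₀ : ℝ} {v : ℝ → ℝ} (hvc : ContinuousOn v (Ici t₀))
    (hvnn : ∀ t ∈ Ici t₀, 0 ≤ v t)
    (hvd : ∀ t ∈ Ici t₀, 0 < v t →
      ∃ d : ℝ, HasDerivWithinAt v d (Ici t₀) t ∧ d ≤ -(1 / Tc) * (1 / Φ (v t)))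
    {s t : ℝ} (hs : t₀ ≤ s) (hst : s ≤ t) (hpos : ∀ r ∈ Ioo s t, 0 < v r) :
    (∫ z in (0:ℝ)..(v t), Φ z) + t / Tc ≤ (∫ z in (0:ℝ)..(v s), Φ z) + s / Tc := by
  have hsub : Icc s t ⊆ Ici t₀ := fun r hr => hs.trans hr.1
  have hderiv : ∀ r ∈ Ioo s t, ∃ d : ℝ,
      HasDerivAt (fun r => (∫ z in (0:ℝ)..(v r), Φ z) + r / Tc) d r ∧ d ≤ 0 := by
    intro r hr
    have hr₀ : t₀ < r := hs.trans_lt hr.1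
    obtain ⟨d, hd, hle⟩ := hvd r hr₀.le (hpos r hr)
    have hF := hasDerivAt_primitive_of_pos hΦc hΦint (hpos r hr)
    refine ⟨_, (hF.comp r (hd.hasDerivAt (Ici_mem_nhds hr₀))).add
      ((hasDerivAt_id r).div_const Tc), ?_⟩
    have hΦr := hΦpos _ (hpos r hr)
    have hmul := mul_le_mul_of_nonneg_left hle hΦr.le
    have heq : Φ (v r) * (-(1 / Tc) * (1 / Φ (v r))) = -(1 / Tc) := by
      field_simp
    linarith
  have hanti : AntitoneOn (fun r => (∫ z in (0:ℝ)..(v r), Φ z) + r / Tc) (Icc s t) := by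
    refine antitoneOn_of_deriv_nonpos (convex_Icc s t) ?_ ?_ ?_
    · exact ((continuousOn_primitive_Ici hΦint).comp (hvc.mono hsub)
        fun r hr => hvnn r (hsub hr)).add (by fun_prop)
    · rw [interior_Icc]
      intro r hr
      obtain ⟨d, hd, -⟩ := hderiv r hr
      exact hd.differentiableAt.differentiableWithinAt
    · rw [interior_Icc]
      intro r hr
      obtain ⟨d, hd, hle⟩ := hderiv r hr
      exact hd.deriv.trans_le hle
  exact hanti (left_mem_Icc.2 hst) (right_mem_Icc.2 hst) hst

theorem stmt8
    (Φ : ℝ → ℝ)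
    (hΦc : ContinuousOn Φ (Set.Ioi 0))
    (hΦpos : ∀ z > (0:ℝ), 0 < Φ z)
    (hΦint : MeasureTheory.IntegrableOn Φ (Set.Ioi 0))
    (hΦ1 : ∫ z in Set.Ioi (0:ℝ), Φ z = 1)
    (Tc t₀ : ℝ) (hTc : 0 < Tc)
    (v : ℝ → ℝ)
    (hvc : ContinuousOn v (Set.Ici t₀))
    (hvnn : ∀ t ∈ Set.Ici t₀, 0 ≤ v t)
    (hvd : ∀ t ∈ Set.Ici t₀, 0 < v t →
      ∃ d : ℝ, HasDerivWithinAt v d (Set.Ici t₀) t ∧ d ≤ -(1 / Tc) * (1 / Φ (v t))) :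
    (∀ t : ℝ, t₀ + Tc * (∫ z in (0:ℝ)..(v t₀), Φ z) ≤ t → v t = 0) ∧
    (∀ t : ℝ, t₀ + Tc ≤ t → v t = 0) := by
  have hFpos : ∀ y > (0:ℝ), 0 < ∫ z in (0:ℝ)..y, Φ z := fun y hy =>
    intervalIntegral.intervalIntegral_pos_of_pos_on
      (intervalIntegrable_zero_of_integrableOn_Ioi hΦint hy.le) (fun z hz => hΦpos z hz.1) hy
  have hv₀ : 0 ≤ v t₀ := hvnn t₀ self_mem_Ici
  have hF₀ : 0 ≤ ∫ z in (0:ℝ)..(v t₀), Φ z := by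
    rcases hv₀.eq_or_lt with h | h
    · simp [← h]
    · exact (hFpos _ h).le
  have hF₁ : ∫ z in (0:ℝ)..(v t₀), Φ z ≤ 1 := by
    rw [intervalIntegral.integral_of_le hv₀, ← hΦ1]
    refine setIntegral_mono_set hΦint ?_ Ioc_subset_Ioi_self.eventuallyLE
    filter_upwards [ae_restrict_mem measurableSet_Ioi] with z hz using (hΦpos z hz).le
  have main : ∀ t : ℝ, t₀ + Tc * (∫ z in (0:ℝ)..(v t₀), Φ z) ≤ t → v t = 0 := by
    intro t ht
    have ht₀ : t₀ ≤ t := by nlinarith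
    by_contra hne
    have hvt : 0 < v t := (hvnn t ht₀).lt_of_ne' hne
    have hFt := hFpos _ hvt
    have key : ∀ s, t₀ ≤ s → s ≤ t → (∀ r ∈ Ioo s t, 0 < v r) →
        t < s + Tc * ∫ z in (0:ℝ)..(v s), Φ z := by
      intro s hs hst hpos
      have h := primitive_comp_add_div_le hΦc hΦpos hΦint hvc hvnn hvd hs hst hpos
      have h' : t / Tc < (∫ z in (0:ℝ)..(v s), Φ z) + s / Tc := by linarith
      rw [div_lt_iff₀ hTc, add_mul, div_mul_cancel₀ _ hTc.ne'] at h'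
      linarith
    by_cases hz : ∃ s ∈ Icc t₀ t, v s = 0
    · have hcomp : IsCompact (Icc t₀ t ∩ v ⁻¹' {0}) :=
        isCompact_Icc.of_isClosed_subset
          ((hvc.mono Icc_subset_Ici_self).preimage_isClosed_of_isClosed isClosed_Icc
            isClosed_singleton) inter_subset_left
      obtain ⟨s, ⟨hs, hvs⟩, hmax⟩ := hcomp.exists_isGreatest hz
      have hvs : v s = 0 := hvs
      have h := key s hs.1 hs.2 fun r hr =>
        (hvnn r (hs.1.trans hr.1.le)).lt_of_ne' fun h0 =>
          (hmax ⟨⟨hs.1.trans hr.1.le, hr.2.le⟩, h0⟩).not_gt hr.1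
      rw [hvs, intervalIntegral.integral_same] at h
      linarith [hs.2]
    · push Not at hz
      have h := key t₀ le_rfl ht₀ fun r hr =>
        (hvnn r hr.1.le).lt_of_ne' (hz r ⟨hr.1.le, hr.2.le⟩)
      linarith
  refine ⟨main, fun t ht => main t ?_⟩
  nlinarith
end

section
/- Let n ≥ 1, let Φ : (0,∞) → (0,∞) be continuous with ∫₀^∞ Φ(z) dz = 1, let T_c > 0, t₀ ∈ ℝ, and x₀ ∈ ℝⁿ \ {0}. Suppose x : [t₀, t₁) → ℝⁿ \ {0} is differentiable with x(t₀) = x₀, x'(t) = −(1/T_c)·(Φ(‖x(t)‖)·‖x(t)‖)⁻¹·x(t) for all t, and lim_{t→t₁⁻} x(t) = 0, where ‖·‖ is the Euclidean norm. Then t ↦ ‖x(t)‖ is differentiable with d/dt ‖x(t)‖ = −(1/T_c)·(1/Φ(‖x(t)‖)), and t₁ − t₀ = T_c∫₀^{‖x₀‖} Φ(z) dz < T_c. -/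
open Set MeasureTheory Filter

/-- A curve whose velocity is a scalar multiple `c • x` of its position has norm changing at rate
`c * ‖x‖`, away from the origin. -/
theorem HasDerivWithinAt.norm_of_smul_self {E : Type*} [NormedAddCommGroup E]
    [InnerProductSpace ℝ E] {x : ℝ → E} {s : Set ℝ} {t c : ℝ}
    (hx : HasDerivWithinAt x (c • x t) s t) (h0 : x t ≠ 0) :
    HasDerivWithinAt (fun u => ‖x u‖) (c * ‖x t‖) s t := by
  have hn : ‖x t‖ ≠ 0 := norm_ne_zero_iff.mpr h0
  have h := hx.norm_sq.sqrt (pow_ne_zero 2 hn)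
  simp only [Real.sqrt_sq (norm_nonneg _)] at h
  convert h using 1
  rw [inner_smul_right, real_inner_self_eq_norm_sq]
  field_simp

theorem hasDerivAt_integral_of_continuousOn_Ioi_s13 {Φ : ℝ → ℝ} (hc : ContinuousOn Φ (Ioi 0))
    (hi : IntegrableOn Φ (Ioi 0)) {r : ℝ} (hr : 0 < r) :
    HasDerivAt (fun u => ∫ z in (0 : ℝ)..u, Φ z) (Φ r) r := by
  refine intervalIntegral.integral_hasDerivAt_right ?_
    (hc.stronglyMeasurableAtFilter isOpen_Ioi r hr) (hc.continuousAt (Ioi_mem_nhds hr))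
  rw [intervalIntegrable_iff_integrableOn_Ioc_of_le hr.le]
  exact hi.mono_set Ioc_subset_Ioi_self

theorem tendsto_integral_nhdsGE_zero {Φ : ℝ → ℝ} (hi : IntegrableOn Φ (Ioi 0)) :
    Tendsto (fun u => ∫ z in (0 : ℝ)..u, Φ z) (nhdsWithin 0 (Ici 0)) (nhds 0) := by
  have hI : IntegrableOn Φ (uIcc 0 1) := by
    rw [uIcc_of_le zero_le_one, integrableOn_Icc_iff_integrableOn_Ioc]
    exact hi.mono_set Ioc_subset_Ioi_self
  have h := intervalIntegral.continuousOn_primitive_interval hI 0 left_mem_uIcc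
  rw [uIcc_of_le zero_le_one] at h
  have h' := h.mono_of_mem_nhdsWithin (Icc_mem_nhdsGE (zero_lt_one' ℝ))
  simpa [ContinuousWithinAt] using h'

theorem integral_lt_integral_Ioi {Φ : ℝ → ℝ} (hpos : ∀ z > (0 : ℝ), 0 < Φ z)
    (hi : IntegrableOn Φ (Ioi 0)) {r : ℝ} (hr : 0 < r) :
    ∫ z in (0 : ℝ)..r, Φ z < ∫ z in Ioi (0 : ℝ), Φ z := by
  have hir : IntegrableOn Φ (Ioi r) := hi.mono_set (Ioi_subset_Ioi hr.le)
  have hsplit := setIntegral_union Ioc_disjoint_Ioi_same measurableSet_Ioi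
    (hi.mono_set Ioc_subset_Ioi_self : IntegrableOn Φ (Ioc 0 r)) hir
  rw [Ioc_union_Ioi_eq_Ioi hr.le, ← intervalIntegral.integral_of_le hr.le] at hsplit
  have htail : 0 < ∫ z in Ioi r, Φ z := by
    rw [setIntegral_pos_iff_support_of_nonneg_ae _ hir]
    · have hsub : Ioi r ⊆ Function.support Φ ∩ Ioi r :=
        fun z hz => ⟨(hpos z (hr.trans hz)).ne', hz⟩
      refine lt_of_lt_of_le ?_ (measure_mono hsub)
      simp
    · filter_upwards [ae_restrict_mem measurableSet_Ioi] with z hz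
      exact (hpos z (hr.trans hz)).le
  linarith

/-- A function with constant derivative `c` on `[a, b)` and left limit `l` at `b` satisfies
`l - f a = c * (b - a)`. -/
theorem sub_eq_mul_of_hasDerivWithinAt_Ico {f : ℝ → ℝ} {a b c l : ℝ} (hab : a < b)
    (hf : ∀ t ∈ Ico a b, HasDerivWithinAt f c (Ico a b) t)
    (hl : Tendsto f (nhdsWithin b (Iio b)) (nhds l)) : l - f a = c * (b - a) := by
  have hg : ∀ t ∈ Ico a b, HasDerivWithinAt (fun u => f u - c * u) 0 (Ico a b) t := fun t ht => by
    have h := (hf t ht).sub ((hasDerivWithinAt_id t (Ico a b)).const_mul c)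
    rwa [mul_one, sub_self] at h
  have hconst : ∀ t ∈ Ico a b, f t - c * t = f a - c * a := fun t ht => by
    have hsub : Icc a t ⊆ Ico a b := Icc_subset_Ico_right ht.2
    exact constant_of_has_deriv_right_zero
      (fun u hu => ((hg u (hsub hu)).continuousWithinAt.mono hsub))
      (fun u hu => (hg u (hsub (Ico_subset_Icc_self hu))).mono_of_mem_nhdsWithin
        (Ico_mem_nhdsGE_of_mem (hsub (Ico_subset_Icc_self hu))))
      t (right_mem_Icc.mpr ht.1)
  have hlim : Tendsto (fun u => f u - c * u) (nhdsWithin b (Iio b)) (nhds (l - c * b)) :=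
    hl.sub ((tendsto_id.mono_left nhdsWithin_le_nhds).const_mul c)
  have hev : (fun u => f u - c * u) =ᶠ[nhdsWithin b (Iio b)] fun _ => f a - c * a := by
    filter_upwards [Ico_mem_nhdsLT hab] with t ht using hconst t ht
  have := tendsto_nhds_unique (hlim.congr' hev) tendsto_const_nhds
  linarith

theorem stmt13
    (n : ℕ) (hn : 1 ≤ n)
    (Φ : ℝ → ℝ)
    (hΦc : ContinuousOn Φ (Set.Ioi 0))
    (hΦpos : ∀ z > (0:ℝ), 0 < Φ z)
    (hΦint : MeasureTheory.IntegrableOn Φ (Set.Ioi 0))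
    (hΦ1 : ∫ z in Set.Ioi (0:ℝ), Φ z = 1)
    (Tc t₀ t₁ : ℝ) (hTc : 0 < Tc) (ht : t₀ < t₁)
    (x₀ : EuclideanSpace ℝ (Fin n)) (hx₀ : x₀ ≠ 0)
    (x : ℝ → EuclideanSpace ℝ (Fin n))
    (hxt₀ : x t₀ = x₀)
    (hxne : ∀ t ∈ Set.Ico t₀ t₁, x t ≠ 0)
    (hxd : ∀ t ∈ Set.Ico t₀ t₁,
      HasDerivWithinAt x ((-(1 / Tc) * (Φ ‖x t‖ * ‖x t‖)⁻¹) • x t) (Set.Ico t₀ t₁) t)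
    (hxlim : Filter.Tendsto x (nhdsWithin t₁ (Set.Iio t₁)) (nhds 0)) :
    (∀ t ∈ Set.Ico t₀ t₁,
      HasDerivWithinAt (fun s => ‖x s‖) (-(1 / Tc) * (1 / Φ ‖x t‖)) (Set.Ico t₀ t₁) t) ∧
    t₁ - t₀ = Tc * ∫ z in (0:ℝ)..‖x₀‖, Φ z ∧
    t₁ - t₀ < Tc := by
  have hpos : ∀ t ∈ Ico t₀ t₁, 0 < ‖x t‖ := fun t h => norm_pos_iff.mpr (hxne t h)
  have hnorm : ∀ t ∈ Ico t₀ t₁,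
      HasDerivWithinAt (fun s => ‖x s‖) (-(1 / Tc) * (1 / Φ ‖x t‖)) (Ico t₀ t₁) t := by
    intro t h
    convert (hxd t h).norm_of_smul_self (hxne t h) using 1
    have := (hpos t h).ne'
    have := (hΦpos _ (hpos t h)).ne'
    field_simp
  have hcomp : ∀ t ∈ Ico t₀ t₁, HasDerivWithinAt (fun s => ∫ z in (0 : ℝ)..‖x s‖, Φ z)
      (-(1 / Tc)) (Ico t₀ t₁) t := by
    intro t h
    have hΦne := (hΦpos _ (hpos t h)).ne'
    have hrate : Φ ‖x t‖ * (-(1 / Tc) * (1 / Φ ‖x t‖)) = -(1 / Tc) := by field_simp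
    rw [← hrate]
    exact (hasDerivAt_integral_of_continuousOn_Ioi_s13 hΦc hΦint (hpos t h)).comp_hasDerivWithinAt t
      (hnorm t h)
  have hlim : Tendsto (fun s => ∫ z in (0 : ℝ)..‖x s‖, Φ z)
      (nhdsWithin t₁ (Iio t₁)) (nhds 0) := by
    refine (tendsto_integral_nhdsGE_zero hΦint).comp
      (tendsto_nhdsWithin_iff.mpr ⟨?_, Eventually.of_forall fun s => norm_nonneg (x s)⟩)
    simpa using hxlim.norm
  have hmain := sub_eq_mul_of_hasDerivWithinAt_Ico ht hcomp hlim
  rw [hxt₀] at hmain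
  have htime : t₁ - t₀ = Tc * ∫ z in (0 : ℝ)..‖x₀‖, Φ z := by
    field_simp at hmain
    linarith
  refine ⟨hnorm, htime, ?_⟩
  have hlt := integral_lt_integral_Ioi hΦpos hΦint (norm_pos_iff.mpr hx₀)
  rw [hΦ1] at hlt
  rw [htime]
  exact mul_lt_of_lt_one_right hTc hlt
end

section
/- Let α, β, p, q, k be positive real numbers with kp < 1 and kq > 1 (hence p < q). Then ∫₀^∞ (α z^p + β z^q)^{−k} dz = Γ((1−kp)/(q−p)) · Γ((kq−1)/(q−p)) · (α/β)^{(1−kp)/(q−p)} / (α^k · Γ(k) · (q−p)), where Γ is the Gamma function. -/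
open Set MeasureTheory Filter

lemma integral_Ioo_rpow_mul_one_sub_rpow {a b : ℝ} (ha : 0 < a) (hb : 0 < b) :
    ∫ x in Ioo (0:ℝ) 1, x ^ (a - 1) * (1 - x) ^ (b - 1) =
      Real.Gamma a * Real.Gamma b / Real.Gamma (a + b) := by
  have h := ProbabilityTheory.beta_eq_betaIntegralReal a b ha hb
  rw [ProbabilityTheory.beta] at h
  have h2 : Complex.betaIntegral a b =
      ((∫ x in (0:ℝ)..1, x ^ (a - 1) * (1 - x) ^ (b - 1) : ℝ) : ℂ) := by
    rw [Complex.betaIntegral, ← intervalIntegral.integral_ofReal]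
    refine intervalIntegral.integral_congr fun x hx => ?_
    rw [uIcc_of_le zero_le_one] at hx
    have h1 : 0 ≤ 1 - x := by linarith [hx.2]
    simp only [Complex.ofReal_mul, Complex.ofReal_cpow hx.1, Complex.ofReal_cpow h1]
    push_cast
    rfl
  rw [h, h2, Complex.ofReal_re, intervalIntegral.integral_of_le zero_le_one,
    integral_Ioc_eq_integral_Ioo]

lemma integral_Ioi_rpow_mul_one_add_rpow {a b : ℝ} (ha : 0 < a) (hb : 0 < b) :
    ∫ t in Ioi (0:ℝ), t ^ (a - 1) * (1 + t) ^ (-(a + b)) =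
      Real.Gamma a * Real.Gamma b / Real.Gamma (a + b) := by
  rw [← integral_Ioo_rpow_mul_one_sub_rpow ha hb]
  have himg : (fun t : ℝ => t / (1 + t)) '' Ioi 0 = Ioo 0 1 := by
    ext x
    constructor
    · rintro ⟨t, ht : 0 < t, rfl⟩
      exact ⟨by positivity, (div_lt_one (by positivity)).2 (by linarith)⟩
    · rintro ⟨h0, h1⟩
      have h2 : 0 < 1 - x := by linarith
      refine ⟨x / (1 - x), div_pos h0 h2, ?_⟩
      field_simp
      ring
  have hderiv : ∀ t ∈ Ioi (0:ℝ),
      HasDerivWithinAt (fun t : ℝ => t / (1 + t)) (((1 + t) ^ 2)⁻¹) (Ioi 0) t := by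
    intro t (ht : 0 < t)
    have h1 : 1 + t ≠ 0 := by positivity
    have := (hasDerivAt_id t).div ((hasDerivAt_id t).const_add 1) h1
    refine (this.congr_deriv ?_).hasDerivWithinAt
    simp only [id]
    field_simp
    ring
  have hinj : InjOn (fun t : ℝ => t / (1 + t)) (Ioi 0) := by
    intro s (hs : 0 < s) t (ht : 0 < t) h
    have h1 : 1 + s ≠ 0 := by positivity
    have h2 : 1 + t ≠ 0 := by positivity
    simp only [div_eq_div_iff h1 h2] at h
    linarith
  rw [← himg, integral_image_eq_integral_abs_deriv_smul measurableSet_Ioi hderiv hinj]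
  refine setIntegral_congr_fun measurableSet_Ioi fun t (ht : 0 < t) => ?_
  have h1 : 0 < 1 + t := by positivity
  have h2 : 1 - t / (1 + t) = (1 + t)⁻¹ := by
    field_simp
    ring
  have h3 : (1 + t) ^ (-(a + b)) =
      ((1 + t) ^ 2)⁻¹ * (((1 + t) ^ (a - 1))⁻¹ * ((1 + t) ^ (b - 1))⁻¹) := by
    rw [← Real.rpow_natCast, ← Real.rpow_neg h1.le, ← Real.rpow_neg h1.le, ← Real.rpow_neg h1.le,
      ← Real.rpow_add h1, ← Real.rpow_add h1]
    congr 1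
    push_cast
    ring
  simp only [smul_eq_mul]
  rw [h2, abs_of_pos (by positivity), Real.div_rpow ht.le h1.le, Real.inv_rpow h1.le, h3]
  ring

theorem stmt14
    (α β p q k : ℝ) (hα : 0 < α) (hβ : 0 < β) (hp : 0 < p) (hq : 0 < q) (hk : 0 < k)
    (hkp : k * p < 1) (hkq : 1 < k * q) :
    ∫ z in Set.Ioi (0:ℝ), (α * z ^ p + β * z ^ q) ^ (-k) =
      Real.Gamma ((1 - k * p) / (q - p)) * Real.Gamma ((k * q - 1) / (q - p)) *
        (α / β) ^ ((1 - k * p) / (q - p)) / (α ^ k * Real.Gamma k * (q - p)) := by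
  have hd : 0 < q - p := sub_pos.2 (lt_of_mul_lt_mul_left (hkp.trans hkq) hk.le)
  set d := q - p with hd_def
  set a := (1 - k * p) / d with ha_def
  set b := (k * q - 1) / d with hb_def
  have ha : 0 < a := div_pos (by linarith) hd
  have hb : 0 < b := div_pos (by linarith) hd
  have hab : a + b = k := by
    rw [ha_def, hb_def, ← add_div, div_eq_iff hd.ne', hd_def]
    ring
  have hda : d * a = 1 - k * p := by
    rw [ha_def]
    field_simp
  have hc : 0 < β / α := div_pos hβ hα
  have hbeta := integral_Ioi_rpow_mul_one_add_rpow ha hb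
  rw [hab] at hbeta
  have hscale := integral_comp_mul_left_Ioi (fun t : ℝ => t ^ (a - 1) * (1 + t) ^ (-k)) 0 hc
  rw [mul_zero, hbeta] at hscale
  have hpow := integral_comp_rpow_Ioi_of_pos
    (g := fun t : ℝ => (β / α * t) ^ (a - 1) * (1 + β / α * t) ^ (-k)) hd
  rw [hscale] at hpow
  have hint : ∫ z in Ioi (0:ℝ), (α * z ^ p + β * z ^ q) ^ (-k) =
      ∫ z in Ioi (0:ℝ), (α ^ (-k) * d⁻¹ * ((β / α) ^ (a - 1))⁻¹) *
        ((d * z ^ (d - 1)) • ((β / α * z ^ d) ^ (a - 1) * (1 + β / α * z ^ d) ^ (-k))) := by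
    refine setIntegral_congr_fun measurableSet_Ioi fun z (hz : 0 < z) => ?_
    have hfac : α * z ^ p + β * z ^ q = α * z ^ p * (1 + β / α * z ^ d) := by
      have : z ^ q = z ^ p * z ^ d := by
        rw [← Real.rpow_add hz, hd_def]
        congr 1
        ring
      rw [this]
      field_simp
    have hzp : (z ^ p) ^ (-k) = z ^ (d - 1) * (z ^ d) ^ (a - 1) := by
      rw [← Real.rpow_mul hz.le, ← Real.rpow_mul hz.le, ← Real.rpow_add hz]
      congr 1
      linarith
    have hca : (β / α) ^ (a - 1) ≠ 0 := by positivity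
    simp only [smul_eq_mul]
    rw [hfac, Real.mul_rpow (by positivity) (by positivity), Real.mul_rpow hα.le (by positivity),
      hzp, Real.mul_rpow hc.le (by positivity)]
    generalize (β / α) ^ (a - 1) = C at hca ⊢
    field_simp
  have hconst : ((β / α) ^ (a - 1))⁻¹ * (β / α)⁻¹ = (α / β) ^ a := by
    rw [← mul_inv, ← Real.rpow_add_one hc.ne', sub_add_cancel, ← Real.inv_rpow hc.le, inv_div]
  rw [hint, integral_const_mul, hpow, ← hconst, Real.rpow_neg hα.le, smul_eq_mul]
  simp only [div_eq_mul_inv, mul_inv]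
  ring
end

section
/- Let α, β, p, q, k be positive real numbers with kp < 1 and kq > 1, and set m_p = (1−kp)/(q−p) and m_q = (kq−1)/(q−p). Then for every x > 0, ∫₀^x (α z^p + β z^q)^{−k} dz = (α/β)^{m_p} / (α^k (q−p)) · ∫₀^{u(x)} ξ^{m_p − 1}(1−ξ)^{m_q − 1} dξ, where u(x) = ((α/β)·x^{p−q} + 1)^{−1} ∈ (0,1). -/
open Set MeasureTheory Filter

theorem hasDerivAt_rpow_div_add_rpow {c t z : ℝ} (hc : 0 < c) (hz : 0 < z) :
    HasDerivAt (fun y : ℝ => y ^ t / (c + y ^ t)) (c * t * z ^ (t - 1) / (c + z ^ t) ^ 2) z := by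
  have hzt : 0 < z ^ t := Real.rpow_pos_of_pos hz t
  have h := Real.hasDerivAt_rpow_const (p := t) (Or.inl hz.ne')
  convert! h.div (h.const_add c) (by positivity) using 1
  ring

theorem integral_rpow_div_add_rpow_comp {c t x : ℝ} (hc : 0 < c) (ht : 0 < t) (hx : 0 < x)
    (g : ℝ → ℝ) :
    ∫ z in (0:ℝ)..x, c * t * z ^ (t - 1) / (c + z ^ t) ^ 2 * g (z ^ t / (c + z ^ t)) =
      ∫ ξ in (0:ℝ)..(x ^ t / (c + x ^ t)), g ξ := by
  have hcont : ContinuousOn (fun y : ℝ => y ^ t / (c + y ^ t)) (uIcc 0 x) := by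
    have h : Continuous fun y : ℝ => y ^ t := Real.continuous_rpow_const ht.le
    refine h.continuousOn.div (continuous_const.add h).continuousOn fun y hy => ?_
    rw [uIcc_of_le hx.le] at hy
    have := Real.rpow_nonneg hy.1 t
    positivity
  have hderiv : ∀ z ∈ Ioo (min 0 x) (max 0 x), 0 < z := fun z hz => by
    simpa [hx.le] using hz.1
  have key := intervalIntegral.integral_deriv_smul_comp_of_deriv_nonneg hcont
    (fun z hz => hasDerivAt_rpow_div_add_rpow hc (hderiv z hz))
    (fun z hz => by have := hderiv z hz; positivity) (g := g)
  simpa [Real.zero_rpow ht.ne'] using key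

theorem rpow_neg_add_eq_deriv_mul_comp {α β p q k z : ℝ} (hα : 0 < α) (hβ : 0 < β)
    (hpq : p < q) (hz : 0 < z) :
    (α * z ^ p + β * z ^ q) ^ (-k) =
      (α / β) ^ ((1 - k * p) / (q - p)) / (α ^ k * (q - p)) *
        ((α / β) * (q - p) * z ^ (q - p - 1) / (α / β + z ^ (q - p)) ^ 2 *
          ((z ^ (q - p) / (α / β + z ^ (q - p))) ^ ((1 - k * p) / (q - p) - 1) *
            (1 - z ^ (q - p) / (α / β + z ^ (q - p))) ^ ((k * q - 1) / (q - p) - 1))) := by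
  have ht : 0 < q - p := sub_pos.2 hpq
  have hn : (k * q - 1) / (q - p) = k - (1 - k * p) / (q - p) := by field_simp; ring
  have hm : (q - p) * ((1 - k * p) / (q - p)) = 1 - k * p := by field_simp
  rw [hn]
  generalize (1 - k * p) / (q - p) = m at *
  have hc : 0 < α / β := div_pos hα hβ
  have hα' : α = α / β * β := by field_simp
  have hD : α * z ^ p + β * z ^ q = β * z ^ p * (α / β + z ^ (q - p)) := by
    rw [Real.rpow_sub hz]; field_simp
  rw [hD]
  have hzt : 0 < z ^ (q - p) := Real.rpow_pos_of_pos hz _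
  have h1 : 1 - z ^ (q - p) / (α / β + z ^ (q - p)) = (α / β) / (α / β + z ^ (q - p)) := by
    have : α / β + z ^ (q - p) ≠ 0 := by positivity
    rw [eq_div_iff this, sub_mul, div_mul_cancel₀ _ this]; ring
  rw [h1, show α ^ k = (α / β) ^ k * β ^ k by
    rw [← Real.mul_rpow hc.le hβ.le, ← hα']]
  have hs : 0 < α / β + z ^ (q - p) := by positivity
  have hzp : 0 < z ^ p := Real.rpow_pos_of_pos hz _
  rw [Real.div_rpow hzt.le hs.le, Real.div_rpow hc.le hs.le, ← Real.rpow_mul hz.le,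
    show (q - p) * (m - 1) = 1 - k * p - (q - p) by rw [← hm]; ring,
    Real.mul_rpow (by positivity) hs.le, Real.mul_rpow hβ.le hzp.le, ← Real.rpow_mul hz.le,
    Real.rpow_neg hβ.le, Real.rpow_neg hs.le]
  have hzz : z ^ (p * -k) = z ^ (q - p - 1) * z ^ (1 - k * p - (q - p)) := by
    rw [← Real.rpow_add hz]; ring_nf
  have hcc : (α / β) ^ k = (α / β) ^ m * (α / β) ^ (k - m - 1) * (α / β) := by
    rw [← Real.rpow_add hc, ← Real.rpow_add_one hc.ne']; ring_nf
  have hss : (α / β + z ^ (q - p)) ^ k = (α / β + z ^ (q - p)) ^ 2 *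
      (α / β + z ^ (q - p)) ^ (m - 1) * (α / β + z ^ (q - p)) ^ (k - m - 1) := by
    rw [← Real.rpow_natCast, ← Real.rpow_add hs, ← Real.rpow_add hs]; push_cast; ring_nf
  rw [hzz, hcc, hss]
  generalize α / β + z ^ (q - p) = s at *
  generalize α / β = c at *
  have := Real.rpow_pos_of_pos hc m
  have := Real.rpow_pos_of_pos hc (k - m - 1)
  have := Real.rpow_pos_of_pos hs (m - 1)
  have := Real.rpow_pos_of_pos hs (k - m - 1)
  field_simp

theorem inv_mul_rpow_sub_add_one {c p q x : ℝ} (hc : 0 < c) (hx : 0 < x) :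
    (c * x ^ (p - q) + 1)⁻¹ = x ^ (q - p) / (c + x ^ (q - p)) := by
  have hxt : 0 < x ^ (q - p) := Real.rpow_pos_of_pos hx _
  rw [← neg_sub q p, Real.rpow_neg hx.le]
  field_simp

theorem stmt17
    (α β p q k : ℝ) (hα : 0 < α) (hβ : 0 < β) (hp : 0 < p) (hq : 0 < q) (hk : 0 < k)
    (hkp : k * p < 1) (hkq : 1 < k * q)
    (x : ℝ) (hx : 0 < x) :
    ((α / β) * x ^ (p - q) + 1)⁻¹ ∈ Set.Ioo (0:ℝ) 1 ∧
    ∫ z in (0:ℝ)..x, (α * z ^ p + β * z ^ q) ^ (-k) =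
      (α / β) ^ ((1 - k * p) / (q - p)) / (α ^ k * (q - p)) *
        ∫ ξ in (0:ℝ)..(((α / β) * x ^ (p - q) + 1)⁻¹),
          ξ ^ ((1 - k * p) / (q - p) - 1) * (1 - ξ) ^ ((k * q - 1) / (q - p) - 1) := by
  have hpq : p < q := lt_of_mul_lt_mul_left (hkp.trans hkq) hk.le
  have hc : 0 < α / β := div_pos hα hβ
  have hxr : 0 < x ^ (p - q) := Real.rpow_pos_of_pos hx _
  refine ⟨⟨by positivity, inv_lt_one_of_one_lt₀ (lt_add_of_pos_left 1 (by positivity))⟩, ?_⟩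
  rw [inv_mul_rpow_sub_add_one hc hx,
    ← integral_rpow_div_add_rpow_comp hc (sub_pos.2 hpq) hx
      (fun ξ => ξ ^ ((1 - k * p) / (q - p) - 1) * (1 - ξ) ^ ((k * q - 1) / (q - p) - 1)),
    ← intervalIntegral.integral_const_mul]
  refine intervalIntegral.integral_congr_ae (Eventually.of_forall fun z hz => ?_)
  rw [uIoc_of_le hx.le] at hz
  exact rpow_neg_add_eq_deriv_mul_comp hα hβ hpq hz.1
end
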